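/- Quantum Lax pair for the deformed trigonometric CMS system: the matrices L, M, H over End_ℂ(F) satisfy [L, H] = [L, M], i.e., L_{ij}∘H_{n,m} − H_{n,m}∘L_{ij} = Σ_a (L_{ia}∘M_{aj} − M_{ia}∘L_{aj}) for all 1 ≤ i, j ≤ n+m. -/

import Mathlib

open Polynomial MvPolynomial

noncomputable section

variable (n m : ℕ)

/-- the polynomial ring ℂ[x₁,…,x_{n+m}] -/
abbrev PR (n m : ℕ) : Type := MvPolynomial (Fin (n + m)) ℂ
/-- F = ℂ(x₁,…,x_{n+m}), the field of rational functions -/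
abbrev F (n m : ℕ) : Type := FractionRing (PR n m)

/-- the embedding ℂ[x₁,…,x_{n+m}] → ℂ(x₁,…,x_{n+m}) -/
def emb (f : PR n m) : F n m := algebraMap _ _ f

/-- image of x_i in F -/
def xi (i : Fin (n + m)) : F n m := emb n m (MvPolynomial.X i)

/-- image of a constant c ∈ ℂ in F -/
def cc (c : ℂ) : F n m := emb n m (MvPolynomial.C c)

/-- the parity p(i): 0 for the first n indices, 1 for the last m (valued in ℤ,
so that k^{p(i)}, k^{1−p(j)}, k^{−p(i)} make sense as zpow in the field F). -/
def pE (i : Fin (n + m)) : ℤ := if (i : ℕ) < n then 0 else 1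

/-- numerator of a chosen fraction representation of z ∈ F -/
def num (z : F n m) : PR n m :=
  (IsLocalization.sec (nonZeroDivisors (PR n m)) z).1

/-- denominator of a chosen fraction representation of z ∈ F -/
def den (z : F n m) : PR n m :=
  ((IsLocalization.sec (nonZeroDivisors (PR n m)) z).2 : PR n m)

/-- the partial derivative ∂/∂x_i on the field of rational functions F,
extending `MvPolynomial.pderiv i` by the quotient rule.  (Since z = num z / den z
for any z, this is exactly the unique extension of ∂/∂x_i to F.) -/
def fder (i : Fin (n + m)) (z : F n m) : F n m :=
  (emb n m (pderiv i (num n m z)) * emb n m (den n m z)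
    - emb n m (num n m z) * emb n m (pderiv i (den n m z)))
  / (emb n m (den n m z)) ^ 2

end

noncomputable section
variable (n m : ℕ) (k : ℂ)

/-- the trigonometric quantum Moser matrix L: L_{ii} = k^{p(i)} x_i ∂/∂x_i, and for
i ≠ j, L_{ij} = multiplication by (1/2) k^{1−p(j)} (x_i + x_j)/(x_i − x_j). -/
def LmatT (i j : Fin (n + m)) : F n m → F n m :=
  if i = j then fun z => (cc n m k) ^ (pE n m i) * (xi n m i * fder n m i z)
  else fun z => (1 / 2) * (cc n m k) ^ (1 - pE n m j)
    * ((xi n m i + xi n m j) * (xi n m i - xi n m j)⁻¹) * z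

/-- the matrix M: for i ≠ j, M_{ij} = multiplication by 2k^{1−p(j)} x_i x_j/(x_i−x_j)²,
and M_{ii} = −Σ_{j≠i} multiplication by 2k^{1−p(j)} x_i x_j/(x_i−x_j)². -/
def MmatT (i j : Fin (n + m)) : F n m → F n m :=
  if i = j then
    fun z => -(∑ l ∈ Finset.univ.erase i,
        2 * (cc n m k) ^ (1 - pE n m l) * (xi n m i * xi n m l)
          * ((xi n m i - xi n m l) ^ 2)⁻¹) * z
  else fun z => 2 * (cc n m k) ^ (1 - pE n m j) * (xi n m i * xi n m j)
    * ((xi n m i - xi n m j) ^ 2)⁻¹ * z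

/-- the deformed trigonometric CMS operator H_{n,m} in exponential coordinates
(potential terms acting by multiplication). -/
def HnmT (z : F n m) : F n m :=
  (∑ i ∈ Finset.univ.filter (fun i : Fin (n + m) => (i : ℕ) < n),
      xi n m i * fder n m i (xi n m i * fder n m i z))
  + cc n m k * (∑ j ∈ Finset.univ.filter (fun j : Fin (n + m) => n ≤ (j : ℕ)),
      xi n m j * fder n m j (xi n m j * fder n m j z))
  - (∑ i : Fin (n + m), ∑ j : Fin (n + m),
      if (i : ℕ) < (j : ℕ) ∧ (j : ℕ) < n then
        2 * cc n m k * (cc n m k + 1) * (xi n m i * xi n m j)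
          * ((xi n m i - xi n m j) ^ 2)⁻¹ else 0) * z
  - (∑ i : Fin (n + m), ∑ j : Fin (n + m),
      if n ≤ (i : ℕ) ∧ (i : ℕ) < (j : ℕ) then
        2 * ((cc n m k)⁻¹ + 1) * (xi n m i * xi n m j)
          * ((xi n m i - xi n m j) ^ 2)⁻¹ else 0) * z
  - (∑ i : Fin (n + m), ∑ j : Fin (n + m),
      if (i : ℕ) < n ∧ n ≤ (j : ℕ) then
        2 * (cc n m k + 1) * (xi n m i * xi n m j)
          * ((xi n m i - xi n m j) ^ 2)⁻¹ else 0) * z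

end

/-! ### The partial derivatives of `F` as derivations -/

lemma emb_ne_zero {n m : ℕ} {f : PR n m} (hf : f ≠ 0) : emb n m f ≠ 0 := by
  simpa [emb] using hf

lemma den_ne_zero (n m : ℕ) (z : F n m) : den n m z ≠ 0 :=
  nonZeroDivisors.ne_zero (IsLocalization.sec (nonZeroDivisors (PR n m)) z).2.2

lemma mul_emb_den (n m : ℕ) (z : F n m) : z * emb n m (den n m z) = emb n m (num n m z) :=
  IsLocalization.sec_spec (nonZeroDivisors (PR n m)) z

lemma eq_num_div_den (n m : ℕ) (z : F n m) :
    z = emb n m (num n m z) / emb n m (den n m z) :=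
  eq_div_of_mul_eq (emb_ne_zero (den_ne_zero n m z)) (mul_emb_den n m z)

/-- The quotient rule: `fder` does not depend on the chosen fraction. -/
lemma fder_div {n m : ℕ} (i : Fin (n + m)) (a : PR n m) {b : PR n m} (hb : b ≠ 0) :
    fder n m i (emb n m a / emb n m b)
      = (emb n m (pderiv i a) * emb n m b - emb n m a * emb n m (pderiv i b))
        / emb n m b ^ 2 := by
  set z := emb n m a / emb n m b with hz
  have hb' := emb_ne_zero hb
  have hq' := emb_ne_zero (den_ne_zero n m z)
  have h1 : emb n m (num n m z) * emb n m b = emb n m a * emb n m (den n m z) := by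
    rw [← mul_emb_den n m z, hz]
    field_simp
  have h0 : num n m z * b = a * den n m z := by
    apply IsFractionRing.injective (PR n m) (F n m)
    simpa [emb] using h1
  have h2 : emb n m (pderiv i (num n m z)) * emb n m b
        + emb n m (num n m z) * emb n m (pderiv i b)
      = emb n m (pderiv i a) * emb n m (den n m z)
        + emb n m a * emb n m (pderiv i (den n m z)) := by
    have := congrArg (fun f => emb n m (pderiv i f)) h0
    simp only [Derivation.leibniz, smul_eq_mul, emb, map_add, map_mul] at this ⊢
    linear_combination this
  unfold fder
  rw [div_eq_div_iff (pow_ne_zero 2 hq') (pow_ne_zero 2 hb')]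
  linear_combination (emb n m (den n m z) * emb n m b) * h2
    - (emb n m (pderiv i b) * emb n m (den n m z)
      + emb n m (pderiv i (den n m z)) * emb n m b) * h1

lemma fder_emb {n m : ℕ} (i : Fin (n + m)) (a : PR n m) :
    fder n m i (emb n m a) = emb n m (pderiv i a) := by
  have := fder_div i a (one_ne_zero (α := PR n m))
  simpa [emb] using this

lemma fder_add {n m : ℕ} (i : Fin (n + m)) (y z : F n m) :
    fder n m i (y + z) = fder n m i y + fder n m i z := by
  have hy := den_ne_zero n m y
  have hz := den_ne_zero n m z
  have hy' := emb_ne_zero hy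
  have hz' := emb_ne_zero hz
  have h : y + z = emb n m (num n m y * den n m z + den n m y * num n m z)
      / emb n m (den n m y * den n m z) := by
    conv_lhs => rw [eq_num_div_den n m y, eq_num_div_den n m z]
    rw [div_add_div _ _ hy' hz']
    simp [emb]
  rw [h, fder_div i _ (mul_ne_zero hy hz)]
  unfold fder
  simp only [Derivation.leibniz, smul_eq_mul, emb, map_add, map_mul] at hy' hz' ⊢
  field_simp
  ring

lemma fder_mul {n m : ℕ} (i : Fin (n + m)) (y z : F n m) :
    fder n m i (y * z) = y * fder n m i z + z * fder n m i y := by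
  have hy := den_ne_zero n m y
  have hz := den_ne_zero n m z
  have hy' := emb_ne_zero hy
  have hz' := emb_ne_zero hz
  have h : y * z = emb n m (num n m y * num n m z) / emb n m (den n m y * den n m z) := by
    conv_lhs => rw [eq_num_div_den n m y, eq_num_div_den n m z]
    rw [div_mul_div_comm]
    simp [emb]
  rw [h, fder_div i _ (mul_ne_zero hy hz)]
  conv_rhs =>
    enter [1, 1]
    rw [eq_num_div_den n m y]
  conv_rhs =>
    enter [2, 1]
    rw [eq_num_div_den n m z]
  unfold fder
  simp only [Derivation.leibniz, smul_eq_mul, emb, map_add, map_mul] at hy' hz' ⊢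
  field_simp
  ring

/-- An additive map on a field satisfying the Leibniz rule, as a derivation. -/
def derivationOfLeibniz {K : Type*} [Field K] (f : K → K)
    (hadd : ∀ y z, f (y + z) = f y + f z) (hmul : ∀ y z, f (y * z) = y * f z + z * f y) :
    Derivation ℤ K K :=
  Derivation.mk' (AddMonoidHom.mk' f hadd).toIntLinearMap hmul

/-- The Euler derivation `x_i ∂/∂x_i` of `F`. -/
noncomputable def eulerDer (n m : ℕ) (i : Fin (n + m)) :=
  derivationOfLeibniz (K := F n m) (fun z => xi n m i * fder n m i z)
    (fun y z => by rw [fder_add, mul_add])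
    (fun y z => by
      rw [fder_mul]
      ring)

lemma eulerDer_apply (n m : ℕ) (i : Fin (n + m)) (z : F n m) :
    eulerDer n m i z = xi n m i * fder n m i z := rfl

lemma eulerDer_xi (n m : ℕ) (l i : Fin (n + m)) :
    eulerDer n m l (xi n m i) = if l = i then xi n m i else 0 := by
  rw [eulerDer_apply]
  conv_lhs => rw [show xi n m i = emb n m (X i) from rfl]
  rw [fder_emb, pderiv_X]
  by_cases h : l = i
  · subst h
    simp [emb]
  · simp [emb, h]

lemma eulerDer_cc (n m : ℕ) (l : Fin (n + m)) (c : ℂ) : eulerDer n m l (cc n m c) = 0 := by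
  rw [eulerDer_apply, cc, fder_emb, pderiv_C]
  simp [emb]

lemma xi_injective (n m : ℕ) : Function.Injective (xi n m) := fun _ _ h =>
  MvPolynomial.X_injective (IsFractionRing.injective (PR n m) (F n m) h)

lemma cc_ne_zero (n m : ℕ) {c : ℂ} (hc : c ≠ 0) : cc n m c ≠ 0 :=
  emb_ne_zero (by simpa using hc)

/-! ### The Lax pair over a field with commuting Euler derivations -/

section Lax

variable {ι K : Type*} [Field K]

/-- `(x_i + x_j) / (2 (x_i - x_j))`, equal to zero for `i = j`. -/
def phi (x : ι → K) (i j : ι) : K := (1 / 2) * ((x i + x j) * (x i - x j)⁻¹)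

/-- `x_i x_j / (x_i - x_j)²`, equal to zero for `i = j`. -/
def pot (x : ι → K) (i j : ι) : K := (x i * x j) * ((x i - x j) ^ 2)⁻¹

lemma phi_self (x : ι → K) (i : ι) : phi x i i = 0 := by simp [phi]

lemma pot_self (x : ι → K) (i : ι) : pot x i i = 0 := by simp [pot]

lemma pot_comm (x : ι → K) (i j : ι) : pot x i j = pot x j i := by
  rw [pot, pot, mul_comm (x i), ← neg_sub, neg_sq]

lemma phi_antisymm (x : ι → K) (i j : ι) : phi x i j = -phi x j i := by
  rw [phi, phi, ← neg_sub, inv_neg, add_comm]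
  ring

lemma phi_pot_three_term [CharZero K] {x : ι → K} (hx : Function.Injective x) {i j l : ι}
    (hij : i ≠ j) (hil : i ≠ l) (hjl : j ≠ l) :
    phi x i l * pot x l j - pot x i l * phi x l j
      = phi x i j * (pot x j l - pot x i l) := by
  have h1 := sub_ne_zero.2 (hx.ne hij)
  have h2 := sub_ne_zero.2 (hx.ne hil)
  have h3 := sub_ne_zero.2 (hx.ne hjl)
  rw [pot_comm x l j, phi_antisymm x l j]
  unfold phi pot
  field_simp
  ring

variable [DecidableEq ι] [CharZero K] {x : ι → K} {D : ι → Derivation ℤ K K}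

lemma der_phi (hx : Function.Injective x)
    (hD : ∀ l i, D l (x i) = if l = i then x i else 0) (l i j : ι) :
    D l (phi x i j)
      = ((if l = j then 1 else 0) - (if l = i then 1 else 0)) * pot x i j := by
  by_cases hij : i = j
  · subst hij
    simp [phi_self]
  have h1 := sub_ne_zero.2 (hx.ne hij)
  have h2 : D l (1 / 2 : K) = 0 := by
    rw [one_div, Derivation.leibniz_inv, show (2 : K) = ((2 : ℕ) : K) by norm_num,
      Derivation.map_natCast, smul_zero]
  unfold phi pot
  simp only [Derivation.leibniz, Derivation.leibniz_inv, smul_eq_mul, map_add, map_sub, hD, h2]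
  by_cases h3 : l = i
  · subst h3
    simp only [if_true, hij, if_false]
    field_simp
    ring
  · by_cases h4 : l = j
    · subst h4
      simp only [if_true, h3, if_false]
      field_simp
      ring
    · simp [h3, h4]

lemma der_pot (hx : Function.Injective x)
    (hD : ∀ l i, D l (x i) = if l = i then x i else 0) (l i j : ι) :
    D l (pot x i j)
      = 2 * ((if l = j then 1 else 0) - (if l = i then 1 else 0)) * (phi x i j * pot x i j) := by
  by_cases hij : i = j
  · subst hij
    simp [pot_self]
  have h1 := sub_ne_zero.2 (hx.ne hij)
  unfold phi pot
  simp only [Derivation.leibniz, Derivation.leibniz_inv, Derivation.leibniz_pow,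
    smul_eq_mul, map_sub, hD]
  by_cases h3 : l = i
  · subst h3
    simp only [if_true, hij, if_false]
    simp
    field_simp
    ring
  · by_cases h4 : l = j
    · subst h4
      simp only [if_true, h3, if_false]
      simp
      field_simp
      ring
    · simp [h3, h4]

/-- The derivative of a potential `∑_{i<j} 2 c_{ij} x_i x_j / (x_i - x_j)²`. -/
lemma der_potential_sum [Fintype ι] [LinearOrder ι] (hx : Function.Injective x)
    (hD : ∀ l i, D l (x i) = if l = i then x i else 0) {c : ι → ι → K}
    (hc : ∀ l i j, D l (c i j) = 0) (hsymm : ∀ i j, c i j = c j i) (l : ι) :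
    D l (∑ i, ∑ j, if i < j then 2 * c i j * pot x i j else 0)
      = -∑ j, 4 * c l j * (phi x l j * pot x l j) := by
  have hterm : ∀ i j, D l (if i < j then 2 * c i j * pot x i j else 0)
      = (if l = j then (if i < l then -(4 * c l i * (phi x l i * pot x l i)) else 0) else 0)
        + (if l = i then (if l < j then -(4 * c l j * (phi x l j * pot x l j)) else 0)
          else 0) := by
    intro i j
    have h2 : D l (2 : K) = 0 := by
      rw [show (2 : K) = ((2 : ℕ) : K) by norm_num, Derivation.map_natCast]
    by_cases hij : i < j
    · simp only [hij, if_true, Derivation.leibniz, smul_eq_mul, hc, h2, der_pot hx hD]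
      by_cases h3 : l = i
      · subst h3
        simp only [hij.ne, hij, if_true, if_false]
        ring
      · by_cases h4 : l = j
        · subst h4
          simp only [h3, hij, if_true, if_false]
          rw [pot_comm x l i, phi_antisymm x l i, hsymm l i]
          ring
        · simp [h3, h4]
    · by_cases h3 : l = i
      · subst h3
        by_cases h4 : l = j
        · subst h4
          simp
        · simp [hij, h4]
      · by_cases h4 : l = j
        · subst h4
          simp [hij, h3]
        · simp [hij, h3, h4]
  simp only [map_sum, hterm, Finset.sum_add_distrib]
  rw [Finset.sum_comm (f := fun i j => if l = i then _ else _)]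
  simp only [Finset.sum_ite_eq, Finset.mem_univ, if_true]
  rw [← Finset.sum_add_distrib, ← Finset.sum_neg_distrib]
  refine Finset.sum_congr rfl fun j _ => ?_
  rcases lt_trichotomy j l with h | h | h
  · simp [h, h.not_gt]
  · subst h
    simp [phi_self]
  · simp [h, h.not_gt]

/-- The Lax matrix with weights `q` and `a`. -/
def laxL (x : ι → K) (D : ι → Derivation ℤ K K) (q a : ι → K) (i j : ι) (z : K) : K :=
  if i = j then q i * D i z else a j * phi x i j * z

/-- The second matrix of the Lax pair with weights `a`. -/
def laxM [Fintype ι] (x : ι → K) (a : ι → K) (i j : ι) (z : K) : K :=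
  if i = j then -(∑ l, 2 * a l * pot x i l) * z else 2 * a j * pot x i j * z

/-- The Schrödinger operator with weights `q` and potential `U`. -/
def laxH [Fintype ι] (D : ι → Derivation ℤ K K) (q : ι → K) (U : K) (z : K) : K :=
  ∑ l, q l * D l (D l z) - U * z

theorem laxL_laxH_commutator_self [Fintype ι] (hx : Function.Injective x)
    (hD : ∀ l i, D l (x i) = if l = i then x i else 0)
    (hcomm : ∀ l i z, D l (D i z) = D i (D l z)) {q a : ι → K} {s : K}
    (hq : ∀ l i, D l (q i) = 0) (ha : ∀ l i, D l (a i) = 0) (hqa : ∀ i, q i + a i = s)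
    {c : ι → ι → K} (hqc : ∀ i j, q i * c i j = a j * s) {U : K}
    (hU : ∀ l, D l U = -∑ j, 4 * c l j * (phi x l j * pot x l j)) (i : ι) (z : K) :
    laxL x D q a i i (laxH D q U z) - laxH D q U (laxL x D q a i i z)
      = ∑ b, (laxL x D q a i b (laxM x a b i z) - laxM x a i b (laxL x D q a b i z)) := by
  have h2 : ∀ l, D l (2 : K) = 0 := fun l => by
    rw [show (2 : K) = ((2 : ℕ) : K) by norm_num, Derivation.map_natCast]
  have hL : laxL x D q a i i (laxH D q U z) - laxH D q U (laxL x D q a i i z)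
      = ∑ b, 4 * (a b * s) * (phi x i b * pot x i b) * z := by
    have : ∑ b, 4 * (a b * s) * (phi x i b * pot x i b) * z = -(q i * D i U * z) := by
      rw [hU, mul_neg, neg_mul, neg_neg, Finset.mul_sum, Finset.sum_mul]
      refine Finset.sum_congr rfl fun b _ => ?_
      rw [← hqc i b]
      ring
    rw [this]
    have h3 : ∀ l, D i (D l (D l z)) = D l (D l (D i z)) := fun l => by
      rw [hcomm i l, hcomm i l]
    simp only [laxL, laxH, if_true, map_sub, map_sum, Derivation.leibniz, smul_eq_mul, hq, h3,
      mul_zero, add_zero, mul_sub, Finset.mul_sum]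
    have h4 : ∀ l, q i * (q l * D l (D l (D i z))) = q l * (q i * D l (D l (D i z))) :=
      fun l => by ring
    simp only [h4]
    ring
  have hR : ∀ b, laxL x D q a i b (laxM x a b i z) - laxM x a i b (laxL x D q a b i z)
      = 4 * (a b * a i) * (phi x i b * pot x i b) * z
        + (if b = i then ∑ l, 4 * (a l * q i) * (phi x i l * pot x i l) * z else 0) := by
    intro b
    by_cases hb : b = i
    · subst hb
      have h5 : ∀ l, D b (2 * a l * pot x b l)
          = -(4 * a l * (phi x b l * pot x b l)) := fun l => by
        by_cases hl : b = l
        · subst hl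
          simp [pot_self]
        · simp only [Derivation.leibniz, smul_eq_mul, ha, h2, der_pot hx hD, hl, if_true, if_false]
          ring
      simp only [laxL, laxM, if_true, Derivation.leibniz, smul_eq_mul, map_neg, map_sum, h5,
        phi_self, Finset.sum_neg_distrib, neg_neg]
      have h6 : ∑ l, 4 * (a l * q b) * (phi x b l * pot x b l) * z
          = q b * (z * ∑ l, 4 * a l * (phi x b l * pot x b l)) := by
        rw [Finset.mul_sum, Finset.mul_sum]
        exact Finset.sum_congr rfl fun l _ => by ring
      rw [h6]
      ring
    · simp only [laxL, laxM, hb, Ne.symm hb, if_false]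
      rw [pot_comm x b i, phi_antisymm x b i]
      ring
  rw [hL]
  simp only [hR, Finset.sum_add_distrib, Finset.sum_ite_eq', Finset.mem_univ, if_true]
  rw [← Finset.sum_add_distrib]
  refine Finset.sum_congr rfl fun b _ => ?_
  rw [← hqa i]
  ring

theorem laxL_laxH_commutator_of_ne [Fintype ι] (hx : Function.Injective x)
    (hD : ∀ l i, D l (x i) = if l = i then x i else 0) {q a : ι → K} {s : K}
    (ha : ∀ l i, D l (a i) = 0) (hqa : ∀ i, q i + a i = s)
    (U : K) {i j : ι} (hij : i ≠ j) (z : K) :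
    laxL x D q a i j (laxH D q U z) - laxH D q U (laxL x D q a i j z)
      = ∑ b, (laxL x D q a i b (laxM x a b j z) - laxM x a i b (laxL x D q a b j z)) := by
  have hji := hij.symm
  have h2 : ∀ l, D l (2 : K) = 0 := fun l => by
    rw [show (2 : K) = ((2 : ℕ) : K) by norm_num, Derivation.map_natCast]
  have hL : laxL x D q a i j (laxH D q U z) - laxH D q U (laxL x D q a i j z)
      = -(a j * (2 * (q i + q j) * (phi x i j * pot x i j) * z
        - 2 * q i * pot x i j * D i z + 2 * q j * pot x i j * D j z)) := by
    have hterm : ∀ l, q l * D l (D l (a j * phi x i j * z))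
        = a j * phi x i j * (q l * D l (D l z))
          + ((if l = i then a j * (2 * q i * (phi x i j * pot x i j) * z
              - 2 * q i * pot x i j * D i z) else 0)
            + (if l = j then a j * (2 * q j * (phi x i j * pot x i j) * z
              + 2 * q j * pot x i j * D j z) else 0)) := by
      intro l
      by_cases h3 : l = i
      · subst h3
        simp only [Derivation.leibniz, smul_eq_mul, ha, der_phi hx hD, der_pot hx hD, hij,
          if_true, if_false, map_add, map_sub, map_zero, Derivation.map_one_eq_zero]
        ring
      · by_cases h4 : l = j
        · subst h4
          simp only [Derivation.leibniz, smul_eq_mul, ha, der_phi hx hD, der_pot hx hD, hji,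
            if_true, if_false, map_add, map_sub, map_zero, Derivation.map_one_eq_zero]
          ring
        · simp only [Derivation.leibniz, smul_eq_mul, ha, der_phi hx hD, h3, h4,
            if_false, map_add, map_sub, map_zero]
          ring
    simp only [laxL, laxH, hij, if_false, hterm, Finset.sum_add_distrib, Finset.sum_ite_eq',
      Finset.mem_univ, if_true, ← Finset.mul_sum]
    ring
  have hR : ∀ b, laxL x D q a i b (laxM x a b j z) - laxM x a i b (laxL x D q a b j z)
      = 2 * a j * phi x i j * z * (a b * pot x j b) - 2 * a j * phi x i j * z * (a b * pot x i b)
        + ((if b = i then 2 * q i * a j * pot x i j * D i z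
              - 4 * q i * a j * (phi x i j * pot x i j) * z
              + 2 * a j * phi x i j * z * (∑ l, a l * pot x i l)
              - 2 * a j * a i * (phi x i j * pot x i j) * z else 0)
          + (if b = j then -(2 * a j * phi x i j * z * (∑ l, a l * pot x j l))
              - 2 * a j * pot x i j * q j * D j z
              + 2 * a j * a j * (phi x i j * pot x i j) * z else 0)) := by
    intro b
    have h5 : ∀ i, ∑ l, 2 * a l * pot x i l = 2 * ∑ l, a l * pot x i l := fun i => by
      rw [Finset.mul_sum]
      exact Finset.sum_congr rfl fun l _ => by ring
    by_cases h3 : b = i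
    · subst h3
      simp only [laxL, laxM, hij, if_true, if_false, h5, Derivation.leibniz, smul_eq_mul, ha, h2,
        der_pot hx hD, pot_self, pot_comm x j b]
      ring
    · by_cases h4 : b = j
      · subst h4
        simp only [laxL, laxM, hij, hji, if_true, if_false, h5, pot_self]
        ring
      · have := phi_pot_three_term hx hij (Ne.symm h3) (Ne.symm h4)
        simp only [laxL, laxM, h3, h4, Ne.symm h3, if_false]
        linear_combination 2 * a b * a j * z * this
  rw [hL]
  simp only [hR, Finset.sum_add_distrib, Finset.sum_sub_distrib, Finset.sum_ite_eq',
    Finset.mem_univ, if_true, ← Finset.mul_sum]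
  linear_combination (2 * a j * phi x i j * pot x i j * z) * (hqa i - hqa j)

end Lax

/-! ### The deformed operators as instances of the weighted Lax pair -/

lemma eulerDer_comm {n m : ℕ} (l i : Fin (n + m)) (z : F n m) :
    eulerDer n m l (eulerDer n m i z) = eulerDer n m i (eulerDer n m l z) := by
  have hpoly : ∀ f : PR n m, eulerDer n m l (eulerDer n m i (emb n m f))
      = eulerDer n m i (eulerDer n m l (emb n m f)) := by
    intro f
    induction f using MvPolynomial.induction_on with
    | C c =>
      change eulerDer n m l (eulerDer n m i (cc n m c))
        = eulerDer n m i (eulerDer n m l (cc n m c))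
      simp [eulerDer_cc]
    | add p q hp hq =>
      have : emb n m (p + q) = emb n m p + emb n m q := by simp [emb]
      simp only [this, map_add, hp, hq]
    | mul_X p r hp =>
      have : emb n m (p * X r) = emb n m p * xi n m r := by simp [emb, xi]
      simp only [this, Derivation.leibniz, smul_eq_mul, map_add, eulerDer_xi, hp]
      split_ifs <;> simp [*, eulerDer_xi] <;> ring
  have hd := emb_ne_zero (den_ne_zero n m z)
  have h1 := congrArg (fun w => eulerDer n m l (eulerDer n m i w)) (mul_emb_den n m z)
  have h2 := congrArg (fun w => eulerDer n m i (eulerDer n m l w)) (mul_emb_den n m z)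
  simp only [Derivation.leibniz, smul_eq_mul, map_add, hpoly] at h1 h2
  apply mul_right_cancel₀ hd
  linear_combination h1 - h2

/-- The weight `k^{p(i)}`. -/
noncomputable def wq (n m : ℕ) (k : ℂ) (i : Fin (n + m)) : F n m := cc n m k ^ pE n m i

/-- The weight `k^{1 - p(i)}`. -/
noncomputable def wa (n m : ℕ) (k : ℂ) (i : Fin (n + m)) : F n m := cc n m k ^ (1 - pE n m i)

lemma eulerDer_wq (n m : ℕ) (k : ℂ) (l i : Fin (n + m)) : eulerDer n m l (wq n m k i) = 0 := by
  unfold wq pE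
  split_ifs <;> simp [eulerDer_cc]

lemma eulerDer_wa (n m : ℕ) (k : ℂ) (l i : Fin (n + m)) : eulerDer n m l (wa n m k i) = 0 := by
  unfold wa pE
  split_ifs <;> simp [eulerDer_cc]

lemma wq_add_wa (n m : ℕ) (k : ℂ) (i : Fin (n + m)) :
    wq n m k i + wa n m k i = 1 + cc n m k := by
  unfold wq wa pE
  split_ifs <;> simp [add_comm]

/-- The coupling constants `k^{1 - p(i)} k^{1 - p(j)} (1 + k⁻¹)`. -/
noncomputable def coupling (n m : ℕ) (k : ℂ) (i j : Fin (n + m)) : F n m :=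
  wa n m k i * wa n m k j * (1 + (cc n m k)⁻¹)

lemma coupling_comm (n m : ℕ) (k : ℂ) (i j : Fin (n + m)) :
    coupling n m k i j = coupling n m k j i := by
  unfold coupling
  ring

lemma eulerDer_coupling (n m : ℕ) (k : ℂ) (l i j : Fin (n + m)) :
    eulerDer n m l (coupling n m k i j) = 0 := by
  simp [coupling, Derivation.leibniz_inv, eulerDer_wa, eulerDer_cc]

lemma wq_mul_coupling (n m : ℕ) {k : ℂ} (hk : k ≠ 0) (i j : Fin (n + m)) :
    wq n m k i * coupling n m k i j = wa n m k j * (1 + cc n m k) := by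
  have hc := cc_ne_zero n m hk
  have h : wq n m k i * wa n m k i = cc n m k := by
    unfold wq wa pE
    split_ifs <;> simp
  have h' : cc n m k * (cc n m k)⁻¹ = 1 := mul_inv_cancel₀ hc
  unfold coupling
  linear_combination wa n m k j * (1 + (cc n m k)⁻¹) * h + wa n m k j * h'

lemma LmatT_eq_laxL (n m : ℕ) (k : ℂ) (i j : Fin (n + m)) (z : F n m) :
    LmatT n m k i j z = laxL (xi n m) (eulerDer n m) (wq n m k) (wa n m k) i j z := by
  unfold LmatT laxL
  split_ifs
  · rfl
  · simp only [wa, phi]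
    ring

lemma MmatT_eq_laxM (n m : ℕ) (k : ℂ) (i j : Fin (n + m)) (z : F n m) :
    MmatT n m k i j z = laxM (xi n m) (wa n m k) i j z := by
  unfold MmatT laxM
  split_ifs
  · rw [← Finset.sum_erase (a := i) Finset.univ (by simp [pot_self])]
    simp only [wa, pot, mul_assoc]
  · simp only [wa, pot]
    ring

lemma HnmT_eq_laxH (n m : ℕ) {k : ℂ} (hk : k ≠ 0) (z : F n m) :
    HnmT n m k z = laxH (eulerDer n m) (wq n m k)
      (∑ i, ∑ j, if i < j then 2 * coupling n m k i j * pot (xi n m) i j else 0) z := by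
  have hc := cc_ne_zero n m hk
  have hkin : ∑ l, wq n m k l * eulerDer n m l (eulerDer n m l z)
      = (∑ i ∈ Finset.univ.filter (fun i : Fin (n + m) => (i : ℕ) < n),
          xi n m i * fder n m i (xi n m i * fder n m i z))
        + cc n m k * (∑ j ∈ Finset.univ.filter (fun j : Fin (n + m) => n ≤ (j : ℕ)),
          xi n m j * fder n m j (xi n m j * fder n m j z)) := by
    rw [Finset.mul_sum, Finset.sum_filter, Finset.sum_filter, ← Finset.sum_add_distrib]
    refine Finset.sum_congr rfl fun l _ => ?_
    simp only [eulerDer_apply, wq, pE]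
    by_cases h : (l : ℕ) < n
    · simp [h]
    · simp [h, not_lt.1 h]
  unfold HnmT laxH
  rw [hkin, sub_sub, sub_sub, ← add_mul, ← add_mul]
  congr 2
  simp only [← Finset.sum_add_distrib]
  refine Finset.sum_congr rfl fun i _ => Finset.sum_congr rfl fun j _ => ?_
  simp only [coupling, wa, pE, pot, Fin.lt_def]
  by_cases hi : (i : ℕ) < n <;> by_cases hj : (j : ℕ) < n <;>
    by_cases hlt : (i : ℕ) < (j : ℕ)
  all_goals first
    | (exfalso; omega)
    | simp only [hi, hj, hlt, not_lt.1, not_le.2, and_true, and_false,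
        if_true, if_false, not_false_eq_true, sub_zero, sub_self, zpow_one,
        zpow_zero, add_zero, zero_add]
  all_goals
    field_simp
    try ring

/-- quantum Lax pair for the deformed trigonometric CMS system:
[L, H] = [L, M] entrywise, where H is the diagonal matrix with each diagonal entry the
deformed trigonometric CMS operator H_{n,m}. -/
theorem quantum_Lax_pair_deformed_trig (n m : ℕ) (k : ℂ) (hk : k ≠ 0)
    (i j : Fin (n + m)) (z : F n m) :
    LmatT n m k i j (HnmT n m k z) - HnmT n m k (LmatT n m k i j z) =
      ∑ a : Fin (n + m),
        (LmatT n m k i a (MmatT n m k a j z)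
          - MmatT n m k i a (LmatT n m k a j z)) := by
  simp only [LmatT_eq_laxL, MmatT_eq_laxM, HnmT_eq_laxH n m hk]
  by_cases hij : i = j
  · subst hij
    exact laxL_laxH_commutator_self (xi_injective n m) (eulerDer_xi n m) eulerDer_comm
      (eulerDer_wq n m k) (eulerDer_wa n m k) (wq_add_wa n m k) (wq_mul_coupling n m hk)
      (der_potential_sum (xi_injective n m) (eulerDer_xi n m) (eulerDer_coupling n m k)
        (coupling_comm n m k)) i z
  · exact laxL_laxH_commutator_of_ne (xi_injective n m) (eulerDer_xi n m)
      (eulerDer_wa n m k) (wq_add_wa n m k) _ hij z
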